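/- Let n ≥ 1 and let w : Fin n → Fin n → EReal be a weight matrix all of whose entries lie in {−1, 0, 1, ⊤}. Then there exists a weight matrix w_c : Fin n → Fin n → EReal, with all entries in {−1, 0, 1, ⊤}, which is a canonical graph of w and which satisfies d_{w_c}(i,j) = d_w(i,j) for all pairs i, j. -/

import Mathlib

open scoped BigOperators

namespace MinMaxAPSP

/-- `p` is a walk from `i` to `j` with `ℓ` hops in the graph with weight matrix `w`
(an ordered pair is an edge iff its weight is not `⊤`). -/
def IsWalk {n : ℕ} (w : Fin n → Fin n → EReal) (i j : Fin n) (ℓ : ℕ)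
    (p : Fin (ℓ+1) → Fin n) : Prop :=
  p 0 = i ∧ p (Fin.last ℓ) = j ∧ ∀ k : Fin ℓ, w (p k.castSucc) (p k.succ) ≠ ⊤

/-- The weight of a walk with `ℓ` hops. -/
noncomputable def walkWeight {n : ℕ} (w : Fin n → Fin n → EReal) (ℓ : ℕ)
    (p : Fin (ℓ+1) → Fin n) : EReal :=
  ∑ k : Fin ℓ, w (p k.castSucc) (p k.succ)

/-- The distance from `i` to `j`: the infimum of the weights of all walks from `i` to `j`
(`⊤` if there is no walk). -/
noncomputable def dist {n : ℕ} (w : Fin n → Fin n → EReal) (i j : Fin n) : EReal :=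
  sInf {x : EReal | ∃ ℓ, ∃ p : Fin (ℓ+1) → Fin n, IsWalk w i j ℓ p ∧ walkWeight w ℓ p = x}

/-- The infimum of the weights of all walks from `i` to `j` with at most `δ` hops
(`⊤` if there is no such walk). -/
noncomputable def distLE {n : ℕ} (w : Fin n → Fin n → EReal) (δ : ℕ) (i j : Fin n) : EReal :=
  sInf {x : EReal | ∃ ℓ ≤ δ, ∃ p : Fin (ℓ+1) → Fin n, IsWalk w i j ℓ p ∧ walkWeight w ℓ p = x}

/-- `w` is `δ`-regular. -/
def IsRegular {n : ℕ} (w : Fin n → Fin n → EReal) (δ : ℕ) : Prop :=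
  ∀ i j : Fin n,
    (dist w i j ≠ ⊥ → dist w i j = distLE w δ i j) ∧
    (dist w i j = ⊥ →
      ∃ ℓ ≤ δ, ∃ p : Fin (ℓ+1) → Fin n, IsWalk w i j ℓ p ∧ walkWeight w ℓ p < 0)

/-- All entries of `w` are in `{-1, 0, 1, ⊤}`. -/
def EntriesInMinusOneZeroOneTop {n : ℕ} (w : Fin n → Fin n → EReal) : Prop :=
  ∀ i j, w i j = -1 ∨ w i j = 0 ∨ w i j = 1 ∨ w i j = ⊤

/-- `p` is a shortest walk from `i` to `j` under `w`. -/
def IsShortestWalk {n : ℕ} (w : Fin n → Fin n → EReal) (i j : Fin n) (ℓ : ℕ)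
    (p : Fin (ℓ+1) → Fin n) : Prop :=
  IsWalk w i j ℓ p ∧ walkWeight w ℓ p = dist w i j

/-- `wc` is a canonical graph of `w`. -/
def IsCanonical {n : ℕ} (w wc : Fin n → Fin n → EReal) : Prop :=
  EntriesInMinusOneZeroOneTop wc ∧
  ∀ (i j : Fin n) (ℓ : ℕ) (p : Fin (ℓ+1) → Fin n), IsShortestWalk w i j ℓ p →
    ∃ ℓ' ≤ ℓ, ∃ p' : Fin (ℓ'+1) → Fin n,
      IsShortestWalk wc i j ℓ' p' ∧
      walkWeight wc ℓ' p' = walkWeight w ℓ p ∧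
      (ℓ' = 1 ∨ ∀ k : Fin ℓ', wc (p' k.castSucc) (p' k.succ) ≠ 0)

/-- `halve x = ⌈x/2⌉` for finite `x`, and `halve (⊥) = ⊥`, `halve (⊤) = ⊤`. -/
noncomputable def halve (x : EReal) : EReal :=
  if x = ⊤ then ⊤ else if x = ⊥ then ⊥ else (((⌈x.toReal / 2⌉ : ℤ) : ℝ) : EReal)


/-- `HasWalk w i j ℓ x`: there is a walk from `i` to `j` with `ℓ` hops and integer weight `x`. -/
inductive HasWalk {n : ℕ} (w : Fin n → Fin n → EReal) (i : Fin n) : Fin n → ℕ → ℤ → Prop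
  | nil : HasWalk w i i 0 0
  | snoc {j k : Fin n} {ℓ : ℕ} {x c : ℤ} :
      HasWalk w i j ℓ x → w j k = ((c : ℝ) : EReal) → HasWalk w i k (ℓ + 1) (x + c)

section

variable {n : ℕ} {w w' : Fin n → Fin n → EReal} {i j k : Fin n} {ℓ m : ℕ} {x y : ℤ}

theorem HasWalk.append (h : HasWalk w i j ℓ x) (h' : HasWalk w j k m y) :
    HasWalk w i k (ℓ + m) (x + y) := by
  induction h' with
  | nil => simpa using h
  | snoc _ hc ih => rw [← add_assoc, ← add_assoc]; exact ih.snoc hc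

theorem HasWalk.exists_isWalk (h : HasWalk w i j ℓ x) :
    ∃ p : Fin (ℓ + 1) → Fin n, IsWalk w i j ℓ p ∧ walkWeight w ℓ p = ((x : ℝ) : EReal) := by
  induction h with
  | nil => exact ⟨fun _ => i, ⟨rfl, rfl, fun a => a.elim0⟩, by simp [walkWeight]⟩
  | @snoc j k ℓ x c _ hc ih =>
    obtain ⟨p, ⟨h0, hl, he⟩, hp⟩ := ih
    refine ⟨Fin.snoc (α := fun _ => Fin n) p k, ⟨?_, Fin.snoc_last _ _, ?_⟩, ?_⟩
    · rw [← Fin.castSucc_zero, Fin.snoc_castSucc, h0]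
    · intro a
      rw [Fin.snoc_castSucc]
      induction a using Fin.lastCases with
      | last => rw [Fin.succ_last, Fin.snoc_last, hl, hc]; exact EReal.coe_ne_top _
      | cast a => rw [Fin.succ_castSucc, Fin.snoc_castSucc]; exact he a
    · rw [walkWeight, Fin.sum_univ_castSucc]
      simp only [Fin.snoc_castSucc, Fin.succ_last, Fin.snoc_last, Fin.succ_castSucc]
      rw [hl, hc, Int.cast_add, EReal.coe_add, ← hp, walkWeight]

theorem HasWalk.dist_le (h : HasWalk w i j ℓ x) : dist w i j ≤ ((x : ℝ) : EReal) := by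
  obtain ⟨p, hp, hx⟩ := h.exists_isWalk
  exact sInf_le ⟨ℓ, p, hp, hx⟩

theorem EntriesInMinusOneZeroOneTop.exists_int (hw : EntriesInMinusOneZeroOneTop w)
    (h : w i j ≠ ⊤) :
    ∃ c : ℤ, (c = -1 ∨ c = 0 ∨ c = 1) ∧ w i j = ((c : ℝ) : EReal) := by
  rcases hw i j with h' | h' | h' | h'
  · exact ⟨-1, by simp, by simp [h']⟩
  · exact ⟨0, by simp, by simp [h']⟩
  · exact ⟨1, by simp, by simp [h']⟩
  · exact absurd h' h

theorem IsWalk.exists_hasWalk (hw : EntriesInMinusOneZeroOneTop w) {p : Fin (ℓ + 1) → Fin n}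
    (h : IsWalk w i j ℓ p) :
    ∃ x : ℤ, walkWeight w ℓ p = ((x : ℝ) : EReal) ∧ HasWalk w i j ℓ x := by
  induction ℓ generalizing j with
  | zero =>
    obtain ⟨h0, hl, -⟩ := h
    obtain rfl : i = j := h0.symm.trans hl
    exact ⟨0, by simp [walkWeight], .nil⟩
  | succ ℓ ih =>
    obtain ⟨h0, hl, he⟩ := h
    obtain ⟨x, hx, hwalk⟩ := ih (j := p (Fin.last ℓ).castSucc) (p := fun a => p a.castSucc)
      ⟨h0, rfl, fun a => he a.castSucc⟩
    obtain ⟨c, -, hc⟩ := hw.exists_int (he (Fin.last ℓ))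
    refine ⟨x + c, ?_, hwalk.snoc (c := c) ?_⟩
    · rw [walkWeight, Fin.sum_univ_castSucc, hc, Int.cast_add, EReal.coe_add, ← hx, walkWeight]
      rfl
    · rw [← hc, Fin.succ_last, hl]

theorem dist_le_iff (hw : EntriesInMinusOneZeroOneTop w) :
    dist w i j ≤ ((x : ℝ) : EReal) ↔ ∃ ℓ, ∃ y ≤ x, HasWalk w i j ℓ y := by
  constructor
  · intro h
    have hlt : dist w i j < (((x + 1 : ℤ) : ℝ) : EReal) :=
      h.trans_lt (EReal.coe_lt_coe_iff.2 (by push_cast; linarith))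
    obtain ⟨_, ⟨ℓ, p, hp, rfl⟩, hlt⟩ := sInf_lt_iff.1 hlt
    obtain ⟨y, hy, hwalk⟩ := hp.exists_hasWalk hw
    rw [hy, EReal.coe_lt_coe_iff, Int.cast_lt] at hlt
    exact ⟨ℓ, y, by omega, hwalk⟩
  · rintro ⟨ℓ, y, hy, h⟩
    exact h.dist_le.trans (by exact_mod_cast hy)

theorem le_dist {a : EReal} (hw : EntriesInMinusOneZeroOneTop w)
    (h : ∀ z : ℤ, dist w i j ≤ ((z : ℝ) : EReal) → a ≤ ((z : ℝ) : EReal)) : a ≤ dist w i j := by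
  refine le_sInf ?_
  rintro _ ⟨ℓ, p, hp, rfl⟩
  obtain ⟨x, hx, hwalk⟩ := hp.exists_hasWalk hw
  exact hx ▸ h x hwalk.dist_le

theorem dist_triangle (hw : EntriesInMinusOneZeroOneTop w)
    (h : dist w i j ≤ ((x : ℝ) : EReal)) (h' : dist w j k ≤ ((y : ℝ) : EReal)) :
    dist w i k ≤ (((x + y : ℤ) : ℝ) : EReal) := by
  obtain ⟨ℓ, a, ha, hwalk⟩ := (dist_le_iff hw).1 h
  obtain ⟨m, b, hb, hwalk'⟩ := (dist_le_iff hw).1 h'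
  exact (dist_le_iff hw).2 ⟨_, _, add_le_add ha hb, hwalk.append hwalk'⟩

theorem dist_le_edge (w : Fin n → Fin n → EReal) (i j : Fin n) : dist w i j ≤ w i j := by
  by_cases h : w i j = ⊤
  · exact h ▸ le_top
  · refine sInf_le ⟨1, ![i, j], ⟨rfl, rfl, fun a => ?_⟩, ?_⟩
    · rw [Subsingleton.elim a 0]; exact h
    · simp [walkWeight]

theorem HasWalk.dist_le_of_edge_le (hw : EntriesInMinusOneZeroOneTop w)
    (hww' : ∀ u v, dist w u v ≤ w' u v) (h : HasWalk w' i j ℓ x) :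
    dist w i j ≤ ((x : ℝ) : EReal) := by
  induction h with
  | nil => exact HasWalk.nil.dist_le
  | snoc _ hc ih => exact dist_triangle hw ih (hc ▸ hww' _ _)

theorem dist_le_dist_of_edge_le (hw : EntriesInMinusOneZeroOneTop w)
    (hw' : EntriesInMinusOneZeroOneTop w') (hww' : ∀ u v, dist w u v ≤ w' u v) :
    dist w i j ≤ dist w' i j := by
  refine le_dist hw' fun z hz => ?_
  obtain ⟨ℓ, y, hy, h⟩ := (dist_le_iff hw').1 hz
  exact (h.dist_le_of_edge_le hw hww').trans (by exact_mod_cast hy)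

/-- A terminal part of a shortest walk is shortest. -/
theorem dist_eq_of_dist_eq_add (hw : EntriesInMinusOneZeroOneTop w)
    (hij : dist w i j ≤ ((x : ℝ) : EReal)) (hjk : dist w j k ≤ ((y : ℝ) : EReal))
    (hik : dist w i k = (((x + y : ℤ) : ℝ) : EReal)) : dist w j k = ((y : ℝ) : EReal) := by
  refine le_antisymm hjk (le_dist hw fun z hz => ?_)
  have h := dist_triangle hw hij hz
  rw [hik] at h
  norm_cast at h ⊢
  omega

/-- An initial part of a shortest walk is shortest. -/
theorem dist_eq_of_dist_eq_add' (hw : EntriesInMinusOneZeroOneTop w)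
    (hij : dist w i j ≤ ((x : ℝ) : EReal)) (hjk : dist w j k ≤ ((y : ℝ) : EReal))
    (hik : dist w i k = (((x + y : ℤ) : ℝ) : EReal)) : dist w i j = ((x : ℝ) : EReal) := by
  refine le_antisymm hij (le_dist hw fun z hz => ?_)
  have h := dist_triangle hw hz hjk
  rw [hik] at h
  norm_cast at h ⊢
  omega

open scoped Classical in
/-- The graph whose edges are the pairs at distance `-1` or `1`, weighted by their distance. -/
noncomputable def unitDistGraph (w : Fin n → Fin n → EReal) (u v : Fin n) : EReal :=
  if dist w u v = -1 ∨ dist w u v = 1 then dist w u v else ⊤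

open scoped Classical in
/-- The graph obtained from `w` by replacing the weight of every pair at distance
`-1`, `0` or `1` by this distance. -/
noncomputable def canonicalGraph (w : Fin n → Fin n → EReal) (u v : Fin n) : EReal :=
  if dist w u v = -1 ∨ dist w u v = 0 ∨ dist w u v = 1 then dist w u v else w u v

theorem dist_le_unitDistGraph (w : Fin n → Fin n → EReal) (u v : Fin n) :
    dist w u v ≤ unitDistGraph w u v := by
  unfold unitDistGraph
  split_ifs
  exacts [le_rfl, le_top]

theorem unitDistGraph_eq {c : ℤ} (hc : c = -1 ∨ c = 1) (h : dist w i j = ((c : ℝ) : EReal)) :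
    unitDistGraph w i j = ((c : ℝ) : EReal) := by
  rw [unitDistGraph, if_pos, h]
  rcases hc with rfl | rfl <;> simp [h]

theorem unitDistGraph_ne_zero (w : Fin n → Fin n → EReal) (u v : Fin n) :
    unitDistGraph w u v ≠ 0 := by
  unfold unitDistGraph
  split_ifs with h
  · rcases h with h | h <;> simp [h]
  · exact EReal.top_ne_zero

theorem canonicalGraph_eq_unitDistGraph (h : unitDistGraph w i j ≠ ⊤) :
    canonicalGraph w i j = unitDistGraph w i j := by
  unfold canonicalGraph unitDistGraph at *
  grind

theorem canonicalGraph_entries (hw : EntriesInMinusOneZeroOneTop w) :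
    EntriesInMinusOneZeroOneTop (canonicalGraph w) := by
  intro u v
  unfold canonicalGraph
  split_ifs with h
  · tauto
  · exact hw u v

theorem dist_le_canonicalGraph (w : Fin n → Fin n → EReal) (u v : Fin n) :
    dist w u v ≤ canonicalGraph w u v := by
  unfold canonicalGraph
  split_ifs
  exacts [le_rfl, dist_le_edge w u v]

theorem canonicalGraph_le (w : Fin n → Fin n → EReal) (u v : Fin n) :
    canonicalGraph w u v ≤ w u v := by
  unfold canonicalGraph
  split_ifs
  exacts [dist_le_edge w u v, le_rfl]

theorem dist_canonicalGraph (hw : EntriesInMinusOneZeroOneTop w) :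
    dist (canonicalGraph w) i j = dist w i j :=
  le_antisymm
    (dist_le_dist_of_edge_le (canonicalGraph_entries hw) hw fun u v =>
      (dist_le_edge _ u v).trans (canonicalGraph_le w u v))
    (dist_le_dist_of_edge_le hw (canonicalGraph_entries hw) (dist_le_canonicalGraph w))

/-- A shortest walk of nonzero weight can be replaced by a walk along pairs at distance `±1`;
the last edge of the new walk is split off for the sake of the induction. -/
theorem HasWalk.exists_unitDistGraph (hw : EntriesInMinusOneZeroOneTop w)
    (h : HasWalk w i j ℓ x) (hx : dist w i j = ((x : ℝ) : EReal)) :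
    x = 0 ∨ ∃ ℓ' u, ∃ y c : ℤ, ℓ' + 1 ≤ ℓ ∧ (c = -1 ∨ c = 1) ∧ x = y + c ∧
      HasWalk (unitDistGraph w) i u ℓ' y ∧ dist w u j = ((c : ℝ) : EReal) := by
  induction h with
  | nil => exact .inl rfl
  | @snoc j k ℓ x c h hc ih =>
    have hjk : dist w j k ≤ ((c : ℝ) : EReal) := hc ▸ dist_le_edge w j k
    have hij := dist_eq_of_dist_eq_add' hw h.dist_le hjk hx
    have hc3 : c = -1 ∨ c = 0 ∨ c = 1 := by
      obtain ⟨c', hc', h'⟩ := hw.exists_int (hc ▸ EReal.coe_ne_top _ : w j k ≠ ⊤)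
      have : c = c' := by rw [hc] at h'; exact_mod_cast h'
      exact this ▸ hc'
    by_cases hc0 : c = 0
    · subst hc0
      rw [add_zero] at hx ⊢
      refine (ih hij).imp_right ?_
      rintro ⟨ℓ', u, y, c', hl, hc', rfl, hwalk, huj⟩
      refine ⟨ℓ', u, y, c', by omega, hc', rfl, hwalk, ?_⟩
      refine dist_eq_of_dist_eq_add hw
        (hwalk.dist_le_of_edge_le hw (dist_le_unitDistGraph w)) ?_ hx
      simpa using dist_triangle hw huj.le hjk
    · right
      have hc2 : c = -1 ∨ c = 1 := by omega
      rcases ih hij with rfl | ⟨ℓ', u, y, c', hl, hc', rfl, hwalk, huj⟩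
      · exact ⟨0, i, 0, c, by omega, hc2, rfl, .nil, by simpa using hx⟩
      · exact ⟨ℓ' + 1, j, y + c', c, by omega, hc2, rfl,
          hwalk.snoc (unitDistGraph_eq hc' huj),
          dist_eq_of_dist_eq_add hw hij.le hjk hx⟩

end

/-- every weight matrix with entries in `{-1,0,1,⊤}` has a canonical graph
with the same distances. -/
theorem stmt2 (n : ℕ) (hn : 1 ≤ n) (w : Fin n → Fin n → EReal)
    (hw : EntriesInMinusOneZeroOneTop w) :
    ∃ wc : Fin n → Fin n → EReal, IsCanonical w wc ∧ ∀ i j, dist wc i j = dist w i j := by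
  refine ⟨canonicalGraph w, ⟨canonicalGraph_entries hw, ?_⟩, fun _ _ => dist_canonicalGraph hw⟩
  rintro i j ℓ p ⟨hp, hpd⟩
  obtain ⟨x, hx, hwalk⟩ := hp.exists_hasWalk hw
  have hd : dist w i j = ((x : ℝ) : EReal) := hpd.symm.trans hx
  simp only [IsShortestWalk, dist_canonicalGraph hw, hd, hx]
  rcases hwalk.exists_unitDistGraph hw hd with rfl | ⟨ℓ', u, y, c, hl, hc, rfl, hu, huj⟩
  · rcases Nat.eq_zero_or_pos ℓ with rfl | hpos
    · refine ⟨0, le_rfl, p, ⟨⟨hp.1, hp.2.1, fun k => k.elim0⟩, ?_⟩, ?_, .inr fun k => k.elim0⟩ <;>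
        simp [walkWeight]
    · have he : canonicalGraph w i j = (((0 : ℤ) : ℝ) : EReal) := by simp [canonicalGraph, hd]
      obtain ⟨p', hp', hpw⟩ := (HasWalk.nil.snoc he).exists_isWalk
      exact ⟨1, hpos, p', ⟨hp', hpw⟩, hpw, .inl rfl⟩
  · obtain ⟨p', ⟨h0, hlast, he⟩, hpw⟩ := (hu.snoc (unitDistGraph_eq hc huj)).exists_isWalk
    have heq := fun k => canonicalGraph_eq_unitDistGraph (he k)
    have hpw' : walkWeight (canonicalGraph w) (ℓ' + 1) p' = (((y + c : ℤ) : ℝ) : EReal) := by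
      rw [← hpw]
      exact Finset.sum_congr rfl fun k _ => heq k
    exact ⟨ℓ' + 1, hl, p', ⟨⟨h0, hlast, fun k => heq k ▸ he k⟩, hpw'⟩, hpw',
      .inr fun k => heq k ▸ unitDistGraph_ne_zero w _ _⟩

end MinMaxAPSP
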